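/- For every integer c ≥ 2 there is no lattice triangle T with area a, boundary lattice point count b, and interior lattice point count i satisfying c·(b/2 − 1) < a < (b/2)·(c+1) − (c+1)². -/

import Mathlib

open MeasureTheory

/-- The point of `ℝ²` corresponding to an integer point. -/
def toR2 (z : ℤ × ℤ) : ℝ × ℝ := ((z.1 : ℝ), (z.2 : ℝ))

/-- A lattice polygon: a two-dimensional convex hull of finitely many integer points. -/
def IsLatticePolygon (P : Set (ℝ × ℝ)) : Prop :=
  ∃ S : Finset (ℤ × ℤ), P = convexHull ℝ (toR2 '' (S : Set (ℤ × ℤ))) ∧ affineSpan ℝ P = ⊤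

/-- A lattice triangle: the convex hull of three affinely independent integer points. -/
def IsLatticeTriangle (T : Set (ℝ × ℝ)) : Prop :=
  ∃ v0 v1 v2 : ℤ × ℤ, AffineIndependent ℝ ![toR2 v0, toR2 v1, toR2 v2] ∧
    T = convexHull ℝ {toR2 v0, toR2 v1, toR2 v2}

/-- The number of lattice points on the boundary. -/
noncomputable def bcount (P : Set (ℝ × ℝ)) : ℕ :=
  Set.ncard {z : ℤ × ℤ | toR2 z ∈ frontier P}

/-- The number of lattice points in the interior. -/
noncomputable def icount (P : Set (ℝ × ℝ)) : ℕ :=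
  Set.ncard {z : ℤ × ℤ | toR2 z ∈ interior P}

/-- The Euclidean area. -/
noncomputable def area (P : Set (ℝ × ℝ)) : ℝ := (volume P).toReal


lemma dvd_gcd_nat (n : ℕ) (a b : ℤ) : n ∣ Int.gcd a b ↔ (n:ℤ) ∣ a ∧ (n:ℤ) ∣ b := by
  rw [← Int.natCast_dvd_natCast, Int.dvd_coe_gcd_iff]

set_option maxHeartbeats 1000000 in
lemma arith_sorted (c g X Y Z K : ℤ) (hc : 2 ≤ c) (hg : 1 ≤ g) (hZ : 1 ≤ Z) (hZY : Z ≤ Y) (hYX : Y ≤ X)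
    (hK : 1 ≤ K) (h1 : c * (g * (X + Y + Z) - 2) < K * g^2 * X * Y * Z)
    (h2 : K * g^2 * X * Y * Z < g * (X + Y + Z) * (c+1) - 2 * (c+1)^2) : False := by
  obtain ⟨d, rfl⟩ : ∃ d, c = d - 1 := ⟨c + 1, by ring⟩
  simp only [sub_add_cancel] at *
  obtain ⟨m, hm⟩ : ∃ m, m = K * g * Y * Z := ⟨_, rfl⟩
  obtain ⟨x, hx⟩ : ∃ x, x = g * X := ⟨_, rfl⟩
  obtain ⟨y, hy⟩ : ∃ y, y = g * Y := ⟨_, rfl⟩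
  obtain ⟨z, hz⟩ : ∃ z, z = g * Z := ⟨_, rfl⟩
  have hA : K * g^2 * X * Y * Z = m * x := by rw [hm, hx]; ring
  have hb : g * (X + Y + Z) = x + y + z := by rw [hx, hy, hz]; ring
  rw [hA, hb] at h1 h2
  have hzg : g ≤ z := by nlinarith
  have hzy : z ≤ y := by nlinarith
  have hyx : y ≤ x := by nlinarith
  have hmd : d ≤ m := by
    by_contra hlt
    have : m ≤ d - 1 := by omega
    nlinarith
  have hyz : 2 * d < y + z := by nlinarith
  have hyd : d < y := by omega
  have h3 : (m - d) * y < d * (y + z - 2 * d) := by nlinarith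
  have hKZ : K * Z = 1 := by
    by_contra hne
    have h2' : 2 ≤ K * Z := by
      have : 1 ≤ K * Z := by nlinarith
      omega
    have : 2 * y ≤ m := by
      have : m = (K * Z) * y := by rw [hm, hy]; ring
      nlinarith
    nlinarith [sq_nonneg (4 * y - 3 * d)]
  have hZ1 : Z = 1 := by nlinarith
  have hK1 : K = 1 := by nlinarith
  subst hZ1 hK1
  have hmy : m = y := by rw [hm, hy]; ring
  subst hmy
  simp only [mul_one] at hz
  subst hz
  by_cases hY : Y = 1
  · subst hY
    simp only [mul_one] at hy
    subst hy
    by_cases hX : X = 1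
    · subst hX
      simp only [mul_one] at hx
      subst hx
      have : x < 2 * d := by nlinarith
      nlinarith [mul_nonneg (show 0 ≤ x - d - 1 by omega) (show 0 ≤ 2 * d - 1 - x by omega)]
    · have : 2 * m ≤ x := by nlinarith [show 2 ≤ X by omega]
      nlinarith
  · have : 2 * z ≤ m := by
      have h8 := mul_le_mul_of_nonneg_left (show 2 ≤ Y by omega) (show 0 ≤ z by omega)
      linarith
    have h5 : 0 ≤ d * (m - 2 * z) := mul_nonneg (by omega) (by omega)
    have h6 : 0 ≤ (4 * m - 5 * d) ^ 2 := sq_nonneg _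
    have h7 : 0 < d * d := mul_pos (by omega) (by omega)
    clear h1 h2 hA hb
    linarith

lemma arith (c g X Y Z K : ℤ) (hc : 2 ≤ c) (hg : 1 ≤ g) (hX : 1 ≤ X) (hY : 1 ≤ Y) (hZ : 1 ≤ Z)
    (hK : 1 ≤ K) (h1 : c * (g * (X + Y + Z) - 2) < K * g^2 * X * Y * Z)
    (h2 : K * g^2 * X * Y * Z < g * (X + Y + Z) * (c+1) - 2 * (c+1)^2) : False := by
  rcases le_total X Y with a | a <;> rcases le_total Y Z with b | b <;> rcases le_total X Z with e | e
  · exact arith_sorted c g Z Y X K hc hg hX a b hK (by convert h1 using 1 <;> ring) (by convert h2 using 1 <;> ring)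
  · exact arith_sorted c g Z Y X K hc hg hX a b hK (by convert h1 using 1 <;> ring) (by convert h2 using 1 <;> ring)
  · exact arith_sorted c g Y Z X K hc hg hX e b hK (by convert h1 using 1 <;> ring) (by convert h2 using 1 <;> ring)
  · exact arith_sorted c g Y X Z K hc hg hZ e a hK (by convert h1 using 1 <;> ring) (by convert h2 using 1 <;> ring)
  · exact arith_sorted c g Z X Y K hc hg hY a e hK (by convert h1 using 1 <;> ring) (by convert h2 using 1 <;> ring)
  · exact arith_sorted c g X Z Y K hc hg hY b e hK (by convert h1 using 1 <;> ring) (by convert h2 using 1 <;> ring)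
  · exact arith_sorted c g X Y Z K hc hg hZ b a hK (by convert h1 using 1 <;> ring) (by convert h2 using 1 <;> ring)
  · exact arith_sorted c g X Y Z K hc hg hZ b a hK (by convert h1 using 1 <;> ring) (by convert h2 using 1 <;> ring)

lemma structure_gcd (u1 u2 w1 w2 : ℤ) (hD : u1 * w2 - u2 * w1 ≠ 0) :
    ∃ g X Y Z K : ℤ, 1 ≤ g ∧ 1 ≤ X ∧ 1 ≤ Y ∧ 1 ≤ Z ∧ 1 ≤ K ∧
      (Int.gcd u1 u2 : ℤ) = g * X ∧ (Int.gcd w1 w2 : ℤ) = g * Y ∧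
      (Int.gcd (w1 - u1) (w2 - u2) : ℤ) = g * Z ∧
      |u1 * w2 - u2 * w1| = K * g^2 * X * Y * Z := by
  obtain ⟨a1, ha1⟩ := Int.gcd_dvd_left u1 u2
  obtain ⟨a2, ha2⟩ := Int.gcd_dvd_right u1 u2
  obtain ⟨b1, hb1⟩ := Int.gcd_dvd_left w1 w2
  obtain ⟨b2, hb2⟩ := Int.gcd_dvd_right w1 w2
  obtain ⟨c1, hc1⟩ := Int.gcd_dvd_left (w1 - u1) (w2 - u2)
  obtain ⟨c2, hc2⟩ := Int.gcd_dvd_right (w1 - u1) (w2 - u2)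
  generalize hx : Int.gcd u1 u2 = x at *
  generalize hy : Int.gcd w1 w2 = y at *
  generalize hz : Int.gcd (w1 - u1) (w2 - u2) = z at *
  have hx0 : 0 < x := by
    rcases Nat.eq_zero_or_pos x with h | h
    · subst h; exfalso; apply hD; rw [ha1, ha2]; simp
    · exact h
  have hy0 : 0 < y := by
    rcases Nat.eq_zero_or_pos y with h | h
    · subst h; exfalso; apply hD; rw [hb1, hb2]; simp
    · exact h
  have hz0 : 0 < z := by
    rcases Nat.eq_zero_or_pos z with h | h
    · subst h; exfalso; apply hD
      simp only [Nat.cast_zero, zero_mul] at hc1 hc2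
      have e1 : w1 = u1 := by linarith
      have e2 : w2 = u2 := by linarith
      rw [e1, e2]; ring
    · exact h
  -- divisibility facts
  have dx : ∀ n : ℕ, (n ∣ x ↔ (n:ℤ) ∣ u1 ∧ (n:ℤ) ∣ u2) := by
    intro n; rw [← hx]; exact dvd_gcd_nat n _ _
  have dy : ∀ n : ℕ, (n ∣ y ↔ (n:ℤ) ∣ w1 ∧ (n:ℤ) ∣ w2) := by
    intro n; rw [← hy]; exact dvd_gcd_nat n _ _
  have dz : ∀ n : ℕ, (n ∣ z ↔ (n:ℤ) ∣ w1 - u1 ∧ (n:ℤ) ∣ w2 - u2) := by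
    intro n; rw [← hz]; exact dvd_gcd_nat n _ _
  have kxy : ∀ n : ℕ, n ∣ x → n ∣ y → n ∣ z := by
    intro n h1 h2
    rw [dx] at h1; rw [dy] at h2; rw [dz]
    exact ⟨dvd_sub h2.1 h1.1, dvd_sub h2.2 h1.2⟩
  have kxz : ∀ n : ℕ, n ∣ x → n ∣ z → n ∣ y := by
    intro n h1 h2
    rw [dx] at h1; rw [dz] at h2; rw [dy]
    exact ⟨by simpa using dvd_add h2.1 h1.1, by simpa using dvd_add h2.2 h1.2⟩
  have kyz : ∀ n : ℕ, n ∣ y → n ∣ z → n ∣ x := by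
    intro n h1 h2
    rw [dy] at h1; rw [dz] at h2; rw [dx]
    exact ⟨by simpa using dvd_sub h1.1 h2.1, by simpa using dvd_sub h1.2 h2.2⟩
  obtain ⟨g, hg⟩ : ∃ g, g = Nat.gcd x y := ⟨_, rfl⟩
  have hg0 : 0 < g := hg ▸ Nat.gcd_pos_of_pos_left _ hx0
  have gx : g ∣ x := hg ▸ Nat.gcd_dvd_left _ _
  have gy : g ∣ y := hg ▸ Nat.gcd_dvd_right _ _
  have gz : g ∣ z := kxy g gx gy
  have key : ∀ n, n ∣ x → n ∣ y → n ∣ g := fun n h1 h2 => hg ▸ Nat.dvd_gcd h1 h2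
  clear hx hy hz hg
  obtain ⟨X, rfl⟩ := gx
  obtain ⟨Y, rfl⟩ := gy
  obtain ⟨Z, rfl⟩ := gz
  have one : ∀ n, g * n ∣ g → n = 1 := by
    intro n hn
    have : g * n ∣ g * 1 := by simpa using hn
    exact Nat.dvd_one.mp (Nat.dvd_of_mul_dvd_mul_left hg0 this)
  have cXZ : Nat.Coprime X Z := by
    apply one
    have h1 := mul_dvd_mul_left g (Nat.gcd_dvd_left X Z)
    exact key _ h1 (kxz _ h1 (mul_dvd_mul_left g (Nat.gcd_dvd_right X Z)))
  have cYZ : Nat.Coprime Y Z := by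
    apply one
    have h1 := mul_dvd_mul_left g (Nat.gcd_dvd_left Y Z)
    exact key _ (kyz _ h1 (mul_dvd_mul_left g (Nat.gcd_dvd_right Y Z))) h1
  have hgz : (g:ℤ) ≠ 0 := by positivity
  have E1 : u1 * w2 - u2 * w1 = (g:ℤ)^2 * ((X * Y) * (a1 * b2 - a2 * b1)) := by
    rw [ha1, ha2, hb1, hb2]; push_cast; ring
  have E2 : u1 * w2 - u2 * w1 = (g:ℤ)^2 * (Z * (X * (a1 * c2 - a2 * c1))) := by
    have : u1 * w2 - u2 * w1 = u1 * (w2 - u2) - u2 * (w1 - u1) := by ring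
    rw [this, hc1, hc2, ha1, ha2]; push_cast; ring
  have hE := mul_left_cancel₀ (pow_ne_zero 2 hgz) (E1.symm.trans E2)
  have hcop : IsCoprime (Z:ℤ) ((X:ℤ) * Y) := by
    rw [← Nat.cast_mul, Nat.isCoprime_iff_coprime]
    exact (Nat.Coprime.mul_left cXZ cYZ).symm
  have hdvd : (Z:ℤ) ∣ (a1 * b2 - a2 * b1) :=
    hcop.dvd_of_dvd_mul_left ⟨_, hE⟩
  obtain ⟨k, hk⟩ := hdvd
  rw [hk] at E1
  have hX := Nat.pos_of_mul_pos_left hx0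
  have hX : 0 < X := Nat.pos_of_ne_zero (by rintro rfl; simp at hx0)
  have hY : 0 < Y := Nat.pos_of_ne_zero (by rintro rfl; simp at hy0)
  have hZ : 0 < Z := Nat.pos_of_ne_zero (by rintro rfl; simp at hz0)
  have hk0 : k ≠ 0 := by rintro rfl; apply hD; rw [E1]; simp
  refine ⟨g, X, Y, Z, |k|, by omega, by omega, by omega, by omega, Int.one_le_abs hk0,
    by push_cast; ring, by push_cast; ring, by push_cast; ring, ?_⟩
  rw [E1]
  simp only [abs_mul, abs_pow, Nat.abs_cast]
  ring

/-- half-open lattice segment -/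
lemma seg_count (p u : ℤ × ℤ) (hu : 0 < Int.gcd u.1 u.2) :
    {z : ℤ × ℤ | ∃ s : ℝ, 0 ≤ s ∧ s < 1 ∧ toR2 z = toR2 p + s • toR2 u}.ncard = Int.gcd u.1 u.2 ∧
    {z : ℤ × ℤ | ∃ s : ℝ, 0 ≤ s ∧ s < 1 ∧ toR2 z = toR2 p + s • toR2 u}.Finite := by
  obtain ⟨e1, h1⟩ := Int.gcd_dvd_left u.1 u.2
  obtain ⟨e2, h2⟩ := Int.gcd_dvd_right u.1 u.2
  have hb := Int.gcd_eq_gcd_ab u.1 u.2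
  generalize Int.gcdA u.1 u.2 = α at hb
  generalize Int.gcdB u.1 u.2 = β at hb
  generalize Int.gcd u.1 u.2 = x at *
  have hx : (x:ℤ) ≠ 0 := by positivity
  have hbez : e1 * α + e2 * β = 1 := by
    apply mul_left_cancel₀ hx
    rw [h1, h2] at hb
    linarith
  have hset : {z : ℤ × ℤ | ∃ s : ℝ, 0 ≤ s ∧ s < 1 ∧ toR2 z = toR2 p + s • toR2 u} =
      ((Finset.range x).image (fun j : ℕ => ((p.1 + j * e1, p.2 + j * e2) : ℤ × ℤ)) : Finset (ℤ × ℤ)) := by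
    ext ⟨z1, z2⟩
    simp only [Set.mem_setOf_eq, Finset.coe_image, Finset.coe_range, Set.mem_image, Set.mem_Iio,
      Prod.mk.injEq, toR2, Prod.smul_mk, Prod.mk_add_mk, smul_eq_mul]
    have hxr : (0:ℝ) < x := by exact_mod_cast hu
    have h1r : (u.1 : ℝ) = x * e1 := by rw [h1]; push_cast; ring
    have h2r : (u.2 : ℝ) = x * e2 := by rw [h2]; push_cast; ring
    have hbr : (e1:ℝ) * α + e2 * β = 1 := by exact_mod_cast hbez
    constructor
    · rintro ⟨s, hs0, hs1, q1, q2⟩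
      rw [h1r] at q1; rw [h2r] at q2
      have hj : (((z1 - p.1) * α + (z2 - p.2) * β : ℤ) : ℝ) = s * x := by
        push_cast; rw [q1, q2]; linear_combination (s * x) * hbr
      have hj0 : 0 ≤ (z1 - p.1) * α + (z2 - p.2) * β := by
        have : (0:ℝ) ≤ (((z1 - p.1) * α + (z2 - p.2) * β : ℤ) : ℝ) := by rw [hj]; positivity
        exact_mod_cast this
      have hjx : (z1 - p.1) * α + (z2 - p.2) * β < x := by
        have : (((z1 - p.1) * α + (z2 - p.2) * β : ℤ) : ℝ) < (x : ℝ) := by rw [hj]; nlinarith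
        exact_mod_cast this
      generalize (z1 - p.1) * α + (z2 - p.2) * β = j at *
      lift j to ℕ using hj0
      refine ⟨j, by exact_mod_cast hjx, ?_, ?_⟩
      · have : ((p.1 + j * e1 : ℤ) : ℝ) = z1 := by
          push_cast; push_cast at hj; rw [q1, hj]; ring
        exact_mod_cast this
      · have : ((p.2 + j * e2 : ℤ) : ℝ) = z2 := by
          push_cast; push_cast at hj; rw [q2, hj]; ring
        exact_mod_cast this
    · rintro ⟨j, hj, rfl, rfl⟩
      refine ⟨j / x, by positivity, ?_, ?_, ?_⟩
      · rw [div_lt_one hxr]; exact_mod_cast hj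
      · rw [h1r]; push_cast; field_simp
      · rw [h2r]; push_cast; field_simp
  rw [hset]
  refine ⟨?_, Finset.finite_toSet _⟩
  rw [Set.ncard_coe_finset, Finset.card_image_of_injective, Finset.card_range]
  intro j k hjk
  simp only [Prod.mk.injEq, add_right_inj] at hjk
  have : (j:ℤ) = k := by linear_combination α * hjk.1 + β * hjk.2 - (j - k) * hbez
  exact_mod_cast this
def Tri : Set (ℝ × ℝ) := {p | 0 ≤ p.1 ∧ 0 ≤ p.2 ∧ p.1 + p.2 ≤ 1}

lemma hull_eq (a b c : ℝ × ℝ) :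
    convexHull ℝ {a, b, c} = (fun p : ℝ × ℝ => a + (p.1 • (b - a) + p.2 • (c - a))) '' Tri := by
  apply Set.Subset.antisymm
  · apply convexHull_min
    · intro q hq
      simp only [Set.mem_insert_iff, Set.mem_singleton_iff] at hq
      rcases hq with rfl | rfl | rfl
      · exact ⟨(0, 0), by simp [Tri], by simp⟩
      · exact ⟨(1, 0), by simp [Tri], by simp⟩
      · exact ⟨(0, 1), by simp [Tri], by simp⟩
    · rintro _ ⟨p, ⟨h1, h2, h3⟩, rfl⟩ _ ⟨q, ⟨k1, k2, k3⟩, rfl⟩ s t hs ht hst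
      refine ⟨s • p + t • q, ⟨?_, ?_, ?_⟩, ?_⟩
      · simp only [Prod.fst_add, Prod.smul_fst, smul_eq_mul]; positivity
      · simp only [Prod.snd_add, Prod.smul_snd, smul_eq_mul]; positivity
      · simp only [Prod.fst_add, Prod.smul_fst, smul_eq_mul, Prod.snd_add, Prod.smul_snd]
        nlinarith
      · obtain rfl : s = 1 - t := by linarith
        simp only [Prod.fst_add, Prod.smul_fst, smul_eq_mul, Prod.snd_add, Prod.smul_snd]
        module
  · rintro _ ⟨⟨s, t⟩, ⟨h1, h2, h3⟩, rfl⟩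
    simp only at h1 h2 h3 ⊢
    have hc := convex_convexHull ℝ {a, b, c}
    have ha : a ∈ convexHull ℝ {a, b, c} := subset_convexHull ℝ _ (by simp)
    have hb : b ∈ convexHull ℝ {a, b, c} := subset_convexHull ℝ _ (by simp)
    have hc' : c ∈ convexHull ℝ {a, b, c} := subset_convexHull ℝ _ (by simp)
    have := hc.sum_mem (t := Finset.univ) (w := ![1 - s - t, s, t]) (z := ![a, b, c])
      (by intro i _; fin_cases i <;> simp <;> linarith)
      (by simp [Fin.sum_univ_three]; ring) (by intro i _; fin_cases i <;> simpa)
    simp only [Fin.sum_univ_three, Matrix.cons_val] at this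
    convert this using 1
    module

lemma tri_closed : IsClosed Tri := by
  apply IsClosed.inter (isClosed_le continuous_const continuous_fst)
  apply IsClosed.inter (isClosed_le continuous_const continuous_snd)
  exact isClosed_le (continuous_fst.add continuous_snd) continuous_const

lemma tri_interior : interior Tri = {p | 0 < p.1 ∧ 0 < p.2 ∧ p.1 + p.2 < 1} := by
  have e : Tri = Prod.fst ⁻¹' (Set.Ici (0:ℝ)) ∩ (Prod.snd ⁻¹' (Set.Ici (0:ℝ)) ∩
    (LinearMap.fst ℝ ℝ ℝ + LinearMap.snd ℝ ℝ ℝ) ⁻¹' (Set.Iic (1:ℝ))) := by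
      ext p; simp [Tri]
  have ho : IsOpenMap (LinearMap.fst ℝ ℝ ℝ + LinearMap.snd ℝ ℝ ℝ) := by
    apply LinearMap.isOpenMap_of_finiteDimensional
    intro x; exact ⟨(x, 0), by simp⟩
  rw [e, interior_inter, interior_inter,
    ← isOpenMap_fst.preimage_interior_eq_interior_preimage continuous_fst,
    ← isOpenMap_snd.preimage_interior_eq_interior_preimage continuous_snd,
    ← ho.preimage_interior_eq_interior_preimage (LinearMap.continuous_of_finiteDimensional _),
    interior_Ici, interior_Iic]
  ext p; simp

lemma tri_frontier (p : ℝ × ℝ) : p ∈ frontier Tri ↔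
    (p.2 = 0 ∧ 0 ≤ p.1 ∧ p.1 < 1) ∨ (p.1 + p.2 = 1 ∧ 0 ≤ p.2 ∧ p.2 < 1) ∨
      (p.1 = 0 ∧ 0 < p.2 ∧ p.2 ≤ 1) := by
  rw [tri_closed.frontier_eq, tri_interior]
  simp only [Tri, Set.mem_diff, Set.mem_setOf_eq]
  constructor
  · rintro ⟨⟨h1, h2, h3⟩, h4⟩
    rcases h2.eq_or_lt with h | h
    · rcases h3.eq_or_lt with k | k
      · right; left; exact ⟨k, h2, by linarith⟩
      · left; exact ⟨h.symm, h1, by linarith⟩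
    · rcases h1.eq_or_lt with k | k
      · right; right; exact ⟨k.symm, h, by linarith⟩
      · have : p.1 + p.2 = 1 := by
          by_contra hne
          exact h4 ⟨k, h, lt_of_le_of_ne h3 hne⟩
        right; left; exact ⟨this, h2, by linarith⟩
  · rintro (⟨h1, h2, h3⟩ | ⟨h1, h2, h3⟩ | ⟨h1, h2, h3⟩)
    · exact ⟨⟨h2, h1.ge, by linarith⟩, fun h => by linarith [h.2.1]⟩
    · exact ⟨⟨by linarith, h2, by linarith⟩, fun h => by linarith [h.2.2]⟩
    · exact ⟨⟨h1.ge, h2.le, by linarith⟩, fun h => by linarith [h.1]⟩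

lemma tri_volume : volume Tri = ENNReal.ofReal (1 / 2) := by
  have hm : MeasurableSet Tri := tri_closed.measurableSet
  have h0 : ∀ x : ℝ, volume (Prod.mk x ⁻¹' Tri) =
      Set.indicator (Set.Icc (0:ℝ) 1) (fun x => ENNReal.ofReal (1 - x)) x := by
    intro x
    by_cases hx : x ∈ Set.Icc (0:ℝ) 1
    · have : Prod.mk x ⁻¹' Tri = Set.Icc 0 (1 - x) := by
        ext y
        simp only [Tri, Set.mem_preimage, Set.mem_setOf_eq, Set.mem_Icc]
        constructor
        · rintro ⟨_, h, h'⟩; exact ⟨h, by linarith⟩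
        · rintro ⟨h, h'⟩; exact ⟨hx.1, h, by linarith⟩
      rw [this, Real.volume_Icc, Set.indicator_of_mem hx, sub_zero]
    · have : Prod.mk x ⁻¹' Tri = ∅ := by
        ext y
        simp only [Tri, Set.mem_preimage, Set.mem_setOf_eq, Set.mem_empty_iff_false, iff_false]
        rintro ⟨h1, h, h'⟩
        exact hx ⟨h1, by linarith⟩
      rw [this, Set.indicator_of_notMem hx, measure_empty]
  rw [Measure.volume_eq_prod, Measure.prod_apply hm]
  simp_rw [h0]
  rw [lintegral_indicator measurableSet_Icc, ← ofReal_integral_eq_lintegral_ofReal]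
  · rw [integral_Icc_eq_integral_Ioc, ← intervalIntegral.integral_of_le zero_le_one]
    congr 1
    rw [intervalIntegral.integral_sub (by simp) (by simp)]
    simp
    norm_num
  · exact (continuous_const.sub continuous_id).integrableOn_Icc
  · filter_upwards [ae_restrict_mem measurableSet_Icc] with x hx
    simp only [Pi.zero_apply]; linarith [hx.2]

noncomputable def Lm (u w : ℝ × ℝ) : (ℝ × ℝ) →ₗ[ℝ] (ℝ × ℝ) :=
  (LinearMap.fst ℝ ℝ ℝ).smulRight u + (LinearMap.snd ℝ ℝ ℝ).smulRight w

lemma Lm_apply (u w p : ℝ × ℝ) : Lm u w p = p.1 • u + p.2 • w := rfl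

lemma Lm_det (u w : ℝ × ℝ) : LinearMap.det (Lm u w) = u.1 * w.2 - u.2 * w.1 := by
  rw [← LinearMap.det_toMatrix (Module.Basis.finTwoProd ℝ), Matrix.det_fin_two]
  simp [LinearMap.toMatrix_apply, Lm_apply]
  ring

lemma area_hull (a b c : ℝ × ℝ) : area (convexHull ℝ {a, b, c}) =
    |(b - a).1 * (c - a).2 - (b - a).2 * (c - a).1| / 2 := by
  have : (fun p : ℝ × ℝ => a + (p.1 • (b - a) + p.2 • (c - a))) '' Tri =
      (fun q => a + q) '' (Lm (b - a) (c - a) '' Tri) := by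
    rw [Set.image_image]; rfl
  rw [area, hull_eq, this, Set.image_add_left, measure_preimage_add,
    Measure.addHaar_image_linearMap, tri_volume, Lm_det, ← ENNReal.ofReal_mul (abs_nonneg _),
    ENNReal.toReal_ofReal (by positivity)]
  ring

lemma frontier_hull (a b c : ℝ × ℝ) (h : (b - a).1 * (c - a).2 - (b - a).2 * (c - a).1 ≠ 0) :
    frontier (convexHull ℝ {a, b, c}) =
      (fun p : ℝ × ℝ => a + (p.1 • (b - a) + p.2 • (c - a))) '' frontier Tri := by
  rw [← Lm_det] at h
  let e := ((Lm (b - a) (c - a)).equivOfDetNeZero h).toContinuousLinearEquiv.toHomeomorph.trans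
    (Homeomorph.addLeft a)
  have he : (fun p : ℝ × ℝ => a + (p.1 • (b - a) + p.2 • (c - a))) = e := rfl
  rw [hull_eq, he, Homeomorph.image_frontier]

lemma det_ne (a b c : ℝ × ℝ) (h : AffineIndependent ℝ ![a, b, c]) :
    (b - a).1 * (c - a).2 - (b - a).2 * (c - a).1 ≠ 0 := by
  intro hD
  rw [affineIndependent_iff] at h
  have key : ∀ s t : ℝ, s • (b - a) + t • (c - a) = 0 → s = 0 ∧ t = 0 := by
    intro s t hst
    have := h Finset.univ ![-s - t, s, t] (by simp [Fin.sum_univ_three]; ring)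
      (by simp only [Fin.sum_univ_three, Matrix.cons_val]; rw [← hst]; module)
    exact ⟨this 1 (by simp), this 2 (by simp)⟩
  generalize b - a = u at *
  generalize c - a = w at *
  have k1 := key w.1 (-u.1) (by ext <;> simp <;> linarith)
  have k2 := key w.2 (-u.2) (by ext <;> simp <;> linarith)
  have := key 1 1 (by ext <;> simp <;> linarith [k1.1, k1.2, k2.1, k2.2])
  linarith [this.1]

lemma toR2_sub (p q : ℤ × ℤ) : toR2 (p - q) = toR2 p - toR2 q := by
  simp [toR2]

lemma bcount_hull (a b c : ℤ × ℤ)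
    (h : (b - a).1 * (c - a).2 - (b - a).2 * (c - a).1 ≠ 0) :
    bcount (convexHull ℝ {toR2 a, toR2 b, toR2 c}) =
      Int.gcd (b - a).1 (b - a).2 + Int.gcd (c - a).1 (c - a).2
        + Int.gcd ((c - a).1 - (b - a).1) ((c - a).2 - (b - a).2) := by
  have hR : (toR2 b - toR2 a).1 * (toR2 c - toR2 a).2
      - (toR2 b - toR2 a).2 * (toR2 c - toR2 a).1 ≠ 0 := by
    rw [← toR2_sub, ← toR2_sub]; simp only [toR2]; exact_mod_cast h
  have inj : ∀ s t s' t' : ℝ, toR2 a + (s • (toR2 b - toR2 a) + t • (toR2 c - toR2 a)) =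
      toR2 a + (s' • (toR2 b - toR2 a) + t' • (toR2 c - toR2 a)) → s = s' ∧ t = t' := by
    intro s t s' t' hh
    have hh := add_left_cancel hh
    generalize toR2 b - toR2 a = u at *
    generalize toR2 c - toR2 a = w at *
    have e1 := congrArg Prod.fst hh
    have e2 := congrArg Prod.snd hh
    simp only [Prod.fst_add, Prod.smul_fst, smul_eq_mul, Prod.snd_add, Prod.smul_snd] at e1 e2
    constructor
    · apply mul_right_cancel₀ hR; linear_combination w.2 * e1 - w.1 * e2
    · apply mul_right_cancel₀ hR; linear_combination u.1 * e2 - u.2 * e1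
  have pos : ∀ u : ℤ × ℤ, u ≠ 0 → 0 < Int.gcd u.1 u.2 := by
    intro u hu
    rw [Int.gcd_pos_iff]
    by_contra hcon
    push Not at hcon
    exact hu (Prod.ext hcon.1 hcon.2)
  have p1 := pos (b - a) (fun h0 => h (by rw [h0]; simp))
  have p2 := pos (c - b) (fun h0 => h (by rw [sub_eq_zero.mp h0]; ring))
  have p3 := pos (a - c) (fun h0 => h (by rw [sub_eq_zero.mp h0]; simp))
  obtain ⟨n1, f1⟩ := seg_count a (b - a) p1
  obtain ⟨n2, f2⟩ := seg_count b (c - b) p2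
  obtain ⟨n3, f3⟩ := seg_count c (a - c) p3
  have g3 : Int.gcd (a - c).1 (a - c).2 = Int.gcd (c - a).1 (c - a).2 := by
    rw [← neg_sub c a, Prod.fst_neg, Prod.snd_neg, Int.gcd_neg, Int.neg_gcd]
  have g2 : Int.gcd (c - b).1 (c - b).2
      = Int.gcd ((c - a).1 - (b - a).1) ((c - a).2 - (b - a).2) := by
    simp
  rw [← g2, ← g3, ← n1, ← n2, ← n3, add_right_comm, bcount, frontier_hull _ _ _ hR]
  rw [← Set.ncard_union_eq _ f1 f2, ← Set.ncard_union_eq _ (f1.union f2) f3]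
  · congr 1
    ext z
    simp only [Set.mem_setOf_eq, Set.mem_image, tri_frontier, Set.mem_union, toR2_sub]
    constructor
    · rintro ⟨⟨s, t⟩, (⟨h1, h2, h3⟩ | ⟨h1, h2, h3⟩ | ⟨h1, h2, h3⟩), hz⟩
      · simp only at h1 h2 h3 hz
        left; left
        refine ⟨s, h2, h3, ?_⟩
        rw [← hz, h1]; module
      · simp only at h1 h2 h3 hz
        left; right
        refine ⟨t, h2, h3, ?_⟩
        rw [← hz, show s = 1 - t by linarith]; module
      · simp only at h1 h2 h3 hz
        right
        refine ⟨1 - t, by linarith, by linarith, ?_⟩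
        rw [← hz, h1]; module
    · rintro ((⟨s, h2, h3, hz⟩ | ⟨s, h2, h3, hz⟩) | ⟨s, h2, h3, hz⟩)
      · refine ⟨(s, 0), Or.inl ⟨rfl, h2, h3⟩, ?_⟩
        rw [hz]; module
      · refine ⟨(1 - s, s), Or.inr (Or.inl ⟨by simp, h2, h3⟩), ?_⟩
        rw [hz]; module
      · refine ⟨(0, 1 - s), Or.inr (Or.inr ⟨rfl, by simpa using h3, by simpa using h2⟩), ?_⟩
        rw [hz]; module
  · rw [Set.disjoint_left]
    rintro z (⟨s, h2, h3, hz⟩ | ⟨s, h2, h3, hz⟩) ⟨t, k2, k3, kz⟩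
    · have := inj s 0 0 (1 - t) (by
        rw [toR2_sub] at hz kz
        rw [hz] at kz
        convert kz using 1 <;> module)
      linarith [this.1, this.2]
    · have := inj (1 - s) s 0 (1 - t) (by
        rw [toR2_sub] at hz kz
        rw [hz] at kz
        convert kz using 1 <;> module)
      linarith [this.1, this.2]
  · rw [Set.disjoint_left]
    rintro z ⟨s, h2, h3, hz⟩ ⟨t, k2, k3, kz⟩
    have := inj s 0 (1 - t) t (by
        rw [toR2_sub] at hz kz
        rw [hz] at kz
        convert kz using 1 <;> module)
    linarith [this.1, this.2]

/-- For every integer `c ≥ 2` there is no lattice triangle `T` with area `a` and boundary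
lattice point count `b` satisfying `c·(b/2 − 1) < a < (b/2)·(c+1) − (c+1)²`. -/
theorem no_lattice_triangle_area_inequalities (c : ℤ) (hc : 2 ≤ c) :
    ¬ ∃ T : Set (ℝ × ℝ), IsLatticeTriangle T ∧
      (c : ℝ) * ((bcount T : ℝ) / 2 - 1) < area T ∧
      area T < (bcount T : ℝ) / 2 * ((c : ℝ) + 1) - ((c : ℝ) + 1) ^ 2 := by
  rintro ⟨T, ⟨v0, v1, v2, hind, rfl⟩, h1, h2⟩
  have hR := det_ne _ _ _ hind
  have hD : (v1 - v0).1 * (v2 - v0).2 - (v1 - v0).2 * (v2 - v0).1 ≠ 0 := by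
    rw [← toR2_sub, ← toR2_sub] at hR; simp only [toR2] at hR; exact_mod_cast hR
  rw [area_hull, bcount_hull _ _ _ hD, ← toR2_sub, ← toR2_sub] at h1 h2
  obtain ⟨g, X, Y, Z, K, hg, hX, hY, hZ, hK, q1, q2, q3, q4⟩ := structure_gcd _ _ _ _ hD
  have hb : ((Int.gcd (v1 - v0).1 (v1 - v0).2 + Int.gcd (v2 - v0).1 (v2 - v0).2
        + Int.gcd ((v2 - v0).1 - (v1 - v0).1) ((v2 - v0).2 - (v1 - v0).2) : ℕ) : ℝ)
        = ((g * (X + Y + Z) : ℤ) : ℝ) := by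
    rw [← Int.cast_natCast (R := ℝ), Int.cast_inj]
    push_cast
    rw [q1, q2, q3]; ring
  have ha : |(toR2 (v1 - v0)).1 * (toR2 (v2 - v0)).2 - (toR2 (v1 - v0)).2 * (toR2 (v2 - v0)).1|
      = ((K * g ^ 2 * X * Y * Z : ℤ) : ℝ) := by
    rw [← q4]; simp only [toR2]; push_cast; rfl
  rw [hb, ha] at h1 h2
  refine arith c g X Y Z K hc hg hX hY hZ hK ?_ ?_
  · have : ((c * (g * (X + Y + Z) - 2) : ℤ) : ℝ) < ((K * g ^ 2 * X * Y * Z : ℤ) : ℝ) := by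
      push_cast at h1 ⊢; linarith
    exact_mod_cast this
  · have : ((K * g ^ 2 * X * Y * Z : ℤ) : ℝ)
        < ((g * (X + Y + Z) * (c + 1) - 2 * (c + 1) ^ 2 : ℤ) : ℝ) := by
      push_cast at h2 ⊢; linarith
    exact_mod_cast this
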